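/- Let d, n ≥ 2. For G = GL_{d^n}(ℂ) = GL((ℂ^d)^{⊗n}), the Hilbert function of J(G) is eventually the constant 24; more precisely, dim_ℂ(R^N / J^N(GL_{d^n}(ℂ))) = 24 for every N ≥ n. -/

import Mathlib

open Matrix

/-- The canonical projection of `W^{⊗N}` (for `W = ℂ^ι`, in its standard basis indexed by
`ι`) onto the `N`-th symmetric power of `W`, realized as the space of homogeneous
polynomials of degree `N` inside the polynomial ring `ℂ[x_i : i ∈ ι]`: the basis tensor
`w_{f 0} ⊗ ⋯ ⊗ w_{f (N-1)}` is sent to the monomial `x_{f 0} ⋯ x_{f (N-1)}`. -/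
noncomputable def phi (ι : Type*) [Fintype ι] (N : ℕ) :
    ((Fin N → ι) → ℂ) →ₗ[ℂ] MvPolynomial ι ℂ where
  toFun v := ∑ f : Fin N → ι, v f • ∏ i, MvPolynomial.X (f i)
  map_add' x y := by simp [add_smul, Finset.sum_add_distrib]
  map_smul' c x := by simp [smul_smul, Finset.smul_sum]

/-- Index of the standard basis of `W = (ℂ^d)^{⊗4} ⊗ ((ℂ^d)^*)^{⊗4}`. -/
abbrev Wix (d : ℕ) := (Fin 4 → Fin d) × (Fin 4 → Fin d)

/-- The action of `g ∈ GL((ℂ^d)^{⊗n})` (with inverse `ginv`) on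
`W^{⊗n} ≅ V^{⊗4} ⊗ (V^*)^{⊗4}` (where `V = (ℂ^d)^{⊗n}`): `g` acts naturally on the four
`V`-factors and contragradiently on the four dual factors. -/
def wAction {d n : ℕ} (g ginv : Matrix (Fin n → Fin d) (Fin n → Fin d) ℂ) :
    Matrix (Fin n → Wix d) (Fin n → Wix d) ℂ :=
  Matrix.of fun f f' =>
    (∏ a : Fin 4, g (fun i => (f i).1 a) (fun i => (f' i).1 a)) *
    (∏ a : Fin 4, ginv (fun i => (f' i).2 a) (fun i => (f i).2 a))

/-- The annihilator `A ⊆ W^{⊗n}` of the space of `G`-invariant linear functionals on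
`W^{⊗n}`. -/
def wAnn (d n : ℕ) (G : Subgroup (Matrix (Fin n → Fin d) (Fin n → Fin d) ℂ)ˣ) :
    Set ((Fin n → Wix d) → ℂ) :=
  {v | ∀ f : ((Fin n → Wix d) → ℂ) →ₗ[ℂ] ℂ,
    (∀ g ∈ G, ∀ w, f (wAction (↑g : Matrix _ _ ℂ) (↑g⁻¹ : Matrix _ _ ℂ) *ᵥ w) = f w) →
      f v = 0}

/-- The ideal `J(G)` of `R = ℂ[x_w : w ∈ Wix d]` generated by `φ(A)`, where `A` is the
annihilator of the `G`-invariant functionals on `W^{⊗n}` and `φ` sends basis tensors to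
monomials. -/
noncomputable def Jideal (d n : ℕ)
    (G : Subgroup (Matrix (Fin n → Fin d) (Fin n → Fin d) ℂ)ˣ) :
    Ideal (MvPolynomial (Wix d) ℂ) :=
  Ideal.span ((phi (Wix d) n) '' (wAnn d n G))

/-- `dim_ℂ (R^N / J^N)`: the value at `N` of the Hilbert function of a homogeneous ideal
`J`, i.e. the codimension in the space `R^N` of homogeneous polynomials of degree `N` of
its subspace `J^N = J ∩ R^N`. -/
noncomputable def hilb {ι : Type*} [Fintype ι] [DecidableEq ι]
    (J : Ideal (MvPolynomial ι ℂ)) (N : ℕ) : ℕ :=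
  Module.finrank ℂ
    ((MvPolynomial.homogeneousSubmodule ι ℂ N) ⧸
      (Submodule.comap (MvPolynomial.homogeneousSubmodule ι ℂ N).subtype
        (Submodule.restrictScalars ℂ J)))

section TensorPower

variable {B : Type*} {r : ℕ}

/-- The matrix of the `r`-th tensor power of the endomorphism `g`. -/
def tensorPow (r : ℕ) (g : Matrix B B ℂ) : Matrix (Fin r → B) (Fin r → B) ℂ :=
  Matrix.of fun p q => ∏ a, g (p a) (q a)

theorem tensorPow_mul [Fintype B] (g h : Matrix B B ℂ) :
    tensorPow r (g * h) = tensorPow r g * tensorPow r h := by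
  ext p q
  simp only [tensorPow, Matrix.of_apply, Matrix.mul_apply, ← Finset.prod_mul_distrib]
  exact Fintype.prod_sum fun a j => g (p a) j * h j (q a)

theorem tensorPow_one [DecidableEq B] : tensorPow r (1 : Matrix B B ℂ) = 1 := by
  ext p q
  simp only [tensorPow, Matrix.of_apply, Matrix.one_apply]
  rw [Fintype.prod_ite_zero]
  simp [funext_iff]

variable [Fintype B] [DecidableEq B]

theorem infinite_det_add_smul_one_ne_zero (g : Matrix B B ℂ) :
    {t : ℂ | (g + t • (1 : Matrix B B ℂ)).det ≠ 0}.Infinite := by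
  have hfin : {t : ℂ | (-g).charpoly.IsRoot t}.Finite :=
    Polynomial.finite_setOfPred_isRoot (Matrix.charpoly_monic _).ne_zero
  refine hfin.infinite_compl.mono fun t (ht : ¬ (-g).charpoly.IsRoot t) hdet => ht ?_
  simp only [Polynomial.IsRoot, Matrix.eval_charpoly]
  rw [← hdet]
  congr 1
  rw [sub_neg_eq_add, add_comm, Matrix.smul_one_eq_diagonal]
  rfl

/-- A matrix commuting with the tensor powers of all invertible matrices commutes with the tensor
powers of all matrices. -/
theorem commute_tensorPow_of_units {M : Matrix (Fin r → B) (Fin r → B) ℂ}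
    (hM : ∀ g : (Matrix B B ℂ)ˣ, M * tensorPow r (g : Matrix B B ℂ) = tensorPow r ↑g * M)
    (g : Matrix B B ℂ) : M * tensorPow r g = tensorPow r g * M := by
  ext q p
  let G (i j : B) : Polynomial ℂ :=
    Polynomial.C (g i j) + Polynomial.X * Polynomial.C ((1 : Matrix B B ℂ) i j)
  have hG (t : ℂ) (i j : B) : (G i j).eval t = (g + t • (1 : Matrix B B ℂ)) i j := by
    simp only [G, Polynomial.eval_add, Polynomial.eval_mul, Polynomial.eval_C, Polynomial.eval_X,
      Matrix.add_apply, Matrix.smul_apply, smul_eq_mul]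
  have key := Polynomial.eq_of_infinite_eval_eq
    (∑ s : Fin r → B, Polynomial.C (M q s) * ∏ a, G (s a) (p a))
    (∑ s : Fin r → B, (∏ a, G (q a) (s a)) * Polynomial.C (M s p)) ?_
  · have := congrArg (Polynomial.eval 0) key
    simpa [Polynomial.eval_finsetSum, Polynomial.eval_prod, hG, Matrix.mul_apply, tensorPow]
      using this
  · refine (infinite_det_add_smul_one_ne_zero g).mono fun t ht => ?_
    have := congrFun₂ (hM (Matrix.GeneralLinearGroup.mkOfDetNeZero _ ht)) q p
    simpa [Polynomial.eval_finsetSum, Polynomial.eval_prod, hG, Matrix.mul_apply, tensorPow,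
      Matrix.GeneralLinearGroup.mkOfDetNeZero] using this

/-- A matrix commuting with all tensor powers is a linear combination of permutation operators. -/
theorem exists_perm_coeff_of_commute_tensorPow {M : Matrix (Fin r → B) (Fin r → B) ℂ}
    (hM : ∀ g : Matrix B B ℂ, M * tensorPow r g = tensorPow r g * M) (e : Fin r ↪ B) :
    ∃ m : Equiv.Perm (Fin r) → ℂ, ∀ q p, M q p = ∑ σ, m σ * if q = p ∘ σ then 1 else 0 := by
  have hsupp (q : Fin r → B) (hq : M q e ≠ 0) : ∃ σ : Equiv.Perm (Fin r), q = e ∘ σ := by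
    have hrange (a : Fin r) : ∃ b, q b = e a := by
      by_contra! hb
      let g : Matrix B B ℂ := Matrix.diagonal fun x => if x = e a then 0 else 1
      have h := congrFun₂ (hM g) q e
      have hleft : ∀ s : Fin r → B, ∏ b, g (s b) (e b) = 0 := fun s =>
        Finset.prod_eq_zero (Finset.mem_univ a) (by
          by_cases h : s a = e a <;> simp [g, h])
      have hright : ∀ s : Fin r → B, ∏ b, g (q b) (s b) = if q = s then 1 else 0 := by
        intro s
        simp only [g, Matrix.diagonal_apply, hb, if_false]
        rw [Fintype.prod_ite_zero]
        simp [funext_iff]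
      simp [Matrix.mul_apply, tensorPow, hleft, hright] at h
      exact hq h.symm
    choose τ hτ using hrange
    have hinj : Function.Injective τ := fun a b hab => e.injective (by rw [← hτ, ← hτ, hab])
    let σ := Equiv.ofBijective τ (Finite.injective_iff_bijective.mp hinj)
    refine ⟨σ.symm, funext fun a => ?_⟩
    have := hτ (σ.symm a)
    rwa [show τ (σ.symm a) = a from σ.apply_symm_apply a] at this
  refine ⟨fun σ => M (fun a => e (σ a)) e, fun q p => ?_⟩
  let g : Matrix B B ℂ := Matrix.of fun x y => if ∃ a, e a = y ∧ x = p a then 1 else 0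
  have hg (x : B) (a : Fin r) : g x (e a) = if x = p a then 1 else 0 := by
    simp [g]
  have h := congrFun₂ (hM g) q e
  simp only [Matrix.mul_apply, tensorPow, Matrix.of_apply, hg] at h
  have hleft : ∀ s : Fin r → B,
      (∏ a, if s a = p a then (1 : ℂ) else 0) = if s = p then 1 else 0 := by
    intro s
    rw [Fintype.prod_ite_zero]
    simp [funext_iff]
  simp only [hleft, mul_ite, mul_one, mul_zero, Finset.sum_ite_eq', Finset.mem_univ, if_true] at h
  rw [h]
  have hinj : Function.Injective fun σ : Equiv.Perm (Fin r) => fun a => e (σ a) :=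
    fun σ τ hστ => Equiv.ext fun a => e.injective (congrFun hστ a)
  rw [← Finset.sum_subset (Finset.subset_univ
    (Finset.univ.image fun σ : Equiv.Perm (Fin r) => fun a => e (σ a)))]
  · rw [Finset.sum_image hinj.injOn]
    refine Finset.sum_congr rfl fun σ _ => ?_
    simp only [hg]
    rw [Fintype.prod_ite_zero]
    simp [funext_iff]
  · intro s _ hs
    by_cases hM0 : M s e = 0
    · simp [hM0]
    · obtain ⟨σ, rfl⟩ := hsupp s hM0
      simp only [Finset.mem_image, Finset.mem_univ, true_and, not_exists] at hs
      exact absurd rfl (hs σ)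

/-- Permutation operators commute with tensor powers. -/
theorem perm_mul_tensorPow (σ : Equiv.Perm (Fin r)) (g : Matrix B B ℂ) :
    (Matrix.of fun q p : Fin r → B => if q = p ∘ σ then (1 : ℂ) else 0) * tensorPow r g =
      tensorPow r g * Matrix.of fun q p : Fin r → B => if q = p ∘ σ then (1 : ℂ) else 0 := by
  ext q p
  have h : ∀ s : Fin r → B, q = s ∘ σ ↔ q ∘ σ.symm = s := fun s => by
    rw [Equiv.comp_symm_eq, eq_comm]
  simp only [Matrix.mul_apply, Matrix.of_apply, tensorPow, h, ite_mul, one_mul, zero_mul,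
    mul_ite, mul_one, mul_zero, Finset.sum_ite_eq, Finset.sum_ite_eq', Finset.mem_univ, if_true]
  rw [← Equiv.prod_comp σ]
  simp

end TensorPower

section Invariants

variable {d n : ℕ}

/-- The point of `ℂ^(Wix d)` with coordinates `∏ a, δ (q a) (p (σ a))`. -/
def permPoint (σ : Equiv.Perm (Fin 4)) (w : Wix d) : ℂ :=
  if w.2 = w.1 ∘ σ then 1 else 0

theorem eval_phi {ι : Type*} [Fintype ι] {N : ℕ} (x : ι → ℂ) (v : (Fin N → ι) → ℂ) :
    MvPolynomial.eval x (phi ι N v) = ∑ f, v f * ∏ i, x (f i) := by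
  simp [phi, MvPolynomial.smul_eval, map_prod]

theorem prod_permPoint (σ : Equiv.Perm (Fin 4)) (P : Fin n → Wix d) :
    ∏ i, permPoint σ (P i) =
      if (fun a i => (P i).2 a) = (fun a i => (P i).1 a) ∘ σ then 1 else 0 := by
  simp only [permPoint]
  rw [Fintype.prod_ite_zero]
  simp only [Finset.prod_const_one, funext_iff, Function.comp_apply]
  congr 1
  exact propext forall_comm

/-- The identification of the index set of `W^{⊗n}` with that of `V^{⊗4} ⊗ (V^*)^{⊗4}`. -/
def indexEquiv (d n : ℕ) :
    (Fin n → Wix d) ≃ (Fin 4 → Fin n → Fin d) × (Fin 4 → Fin n → Fin d) where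
  toFun P := (fun a i => (P i).1 a, fun a i => (P i).2 a)
  invFun P i := (fun a => P.1 a i, fun a => P.2 a i)
  left_inv _ := rfl
  right_inv _ := rfl

/-- The operator on `V^{⊗4}` corresponding to a linear functional on `W^{⊗n}`. -/
def functionalMatrix (f : ((Fin n → Wix d) → ℂ) →ₗ[ℂ] ℂ) :
    Matrix (Fin 4 → Fin n → Fin d) (Fin 4 → Fin n → Fin d) ℂ :=
  Matrix.of fun q p => f (Pi.single ((indexEquiv d n).symm (p, q)) 1)

theorem functional_apply (f : ((Fin n → Wix d) → ℂ) →ₗ[ℂ] ℂ) (v : (Fin n → Wix d) → ℂ) :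
    f v = ∑ P, v P * functionalMatrix f (indexEquiv d n P).2 (indexEquiv d n P).1 := by
  rw [LinearMap.pi_apply_eq_sum_univ f v]
  refine Finset.sum_congr rfl fun P _ => ?_
  simp only [functionalMatrix, Matrix.of_apply, Prod.mk.eta, Equiv.symm_apply_apply, smul_eq_mul]
  congr 2
  ext Q
  simp [Pi.single_apply, eq_comm]

theorem functional_wAction_single (f : ((Fin n → Wix d) → ℂ) →ₗ[ℂ] ℂ)
    (g ginv : Matrix (Fin n → Fin d) (Fin n → Fin d) ℂ) (P : Fin n → Wix d) :
    f (wAction g ginv *ᵥ Pi.single P 1) =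
      (tensorPow 4 ginv * functionalMatrix f * tensorPow 4 g)
        (indexEquiv d n P).2 (indexEquiv d n P).1 := by
  rw [functional_apply, Matrix.mulVec_single_one, Matrix.mul_apply,
    ← (indexEquiv d n).symm.sum_comp, Fintype.sum_prod_type]
  refine Finset.sum_congr rfl fun p _ => ?_
  rw [Matrix.mul_apply, Finset.sum_mul]
  refine Finset.sum_congr rfl fun q _ => ?_
  simp only [Equiv.apply_symm_apply]
  change (tensorPow 4 g p (indexEquiv d n P).1 * tensorPow 4 ginv (indexEquiv d n P).2 q) * _ = _
  ring

theorem functional_invariant_iff (f : ((Fin n → Wix d) → ℂ) →ₗ[ℂ] ℂ)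
    (g ginv : Matrix (Fin n → Fin d) (Fin n → Fin d) ℂ) :
    (∀ w, f (wAction g ginv *ᵥ w) = f w) ↔
      tensorPow 4 ginv * functionalMatrix f * tensorPow 4 g = functionalMatrix f := by
  constructor
  · intro h
    ext q p
    have := h (Pi.single ((indexEquiv d n).symm (p, q)) 1)
    rwa [functional_wAction_single, Equiv.apply_symm_apply] at this
  · intro h
    have : f ∘ₗ (wAction g ginv).mulVecLin = f := by
      refine LinearMap.pi_ext' fun P => LinearMap.ext_ring ?_
      simp only [LinearMap.comp_apply, LinearMap.single_apply, Matrix.mulVecLin_apply]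
      rw [functional_wAction_single, h]
      simp [functionalMatrix]
    exact fun w => congrArg (fun F => F w) this

theorem functionalMatrix_eval_phi (σ : Equiv.Perm (Fin 4)) :
    functionalMatrix ((MvPolynomial.aeval (permPoint σ)).toLinearMap ∘ₗ phi (Wix d) n) =
      Matrix.of fun q p : Fin 4 → Fin n → Fin d => if q = p ∘ σ then (1 : ℂ) else 0 := by
  ext q p
  simp only [functionalMatrix, Matrix.of_apply, LinearMap.comp_apply,
    AlgHom.toLinearMap_apply]
  rw [MvPolynomial.aeval_eq_eval, eval_phi]
  simp only [prod_permPoint]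
  rw [Finset.sum_eq_single ((indexEquiv d n).symm (p, q))]
  · simp only [Pi.single_eq_same, one_mul]
    rfl
  · intro P _ hP
    simp [hP]
  · simp

theorem mem_wAnn_iff (h : 4 ≤ d ^ n) (v : (Fin n → Wix d) → ℂ) :
    v ∈ wAnn d n ⊤ ↔ ∀ σ, MvPolynomial.eval (permPoint σ) (phi (Wix d) n v) = 0 := by
  constructor
  · intro hv σ
    refine hv ((MvPolynomial.aeval (permPoint σ)).toLinearMap ∘ₗ phi (Wix d) n) fun g _ => ?_
    rw [functional_invariant_iff, functionalMatrix_eval_phi, mul_assoc, perm_mul_tensorPow,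
      ← mul_assoc, ← tensorPow_mul, Units.inv_mul, tensorPow_one, one_mul]
  · intro hv f hf
    have hcomm (g : (Matrix (Fin n → Fin d) (Fin n → Fin d) ℂ)ˣ) :
        functionalMatrix f * tensorPow 4 (g : Matrix _ _ ℂ) =
          tensorPow 4 ↑g * functionalMatrix f := by
      have := (functional_invariant_iff f _ _).mp (hf g trivial)
      conv_rhs => rw [← this, ← mul_assoc, ← mul_assoc, ← tensorPow_mul, Units.mul_inv,
        tensorPow_one, one_mul]
    obtain ⟨e⟩ : Nonempty (Fin 4 ↪ (Fin n → Fin d)) :=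
      Function.Embedding.nonempty_of_card_le (by simpa using h)
    obtain ⟨m, hm⟩ := exists_perm_coeff_of_commute_tensorPow (commute_tensorPow_of_units hcomm) e
    have hsum : f v = ∑ σ, m σ * MvPolynomial.eval (permPoint σ) (phi (Wix d) n v) := by
      rw [functional_apply]
      simp only [hm, eval_phi, prod_permPoint, Finset.mul_sum]
      rw [Finset.sum_comm]
      refine Finset.sum_congr rfl fun σ _ => Finset.sum_congr rfl fun P _ => ?_
      rw [mul_left_comm]
      rfl
    simp [hsum, hv]

end Invariants

section Phi

variable {ι : Type*} [Fintype ι]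

theorem exists_phi_eq_of_isHomogeneous {N : ℕ} {p : MvPolynomial ι ℂ} (hp : p.IsHomogeneous N) :
    ∃ v, phi ι N v = p := by
  classical
  suffices p ∈ LinearMap.range (phi ι N) from this
  rw [p.as_sum]
  refine Submodule.sum_mem _ fun s hs => ?_
  have hcard : s.toMultiset.toList.length = N := by
    rw [Multiset.length_toList, Finsupp.card_toMultiset]
    exact hp.degree_eq_sum_deg_support hs |>.symm
  subst hcard
  refine ⟨Pi.single (fun i => s.toMultiset.toList.get i) (p.coeff s), ?_⟩
  have hprod : ∏ i, (MvPolynomial.X (s.toMultiset.toList.get i) : MvPolynomial ι ℂ) =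
      MvPolynomial.monomial s 1 := by
    rw [MvPolynomial.monomial_eq, MvPolynomial.C_1, one_mul]
    refine (Fin.prod_univ_fun_getElem s.toMultiset.toList MvPolynomial.X).trans ?_
    rw [← Multiset.prod_coe, ← Multiset.map_coe, Multiset.coe_toList, Finsupp.toMultiset_map,
      Finsupp.prod_toMultiset, Finsupp.prod_mapDomain_index (by simp) (by simp [pow_add])]
  simp only [phi, LinearMap.coe_mk, AddHom.coe_mk]
  rw [Finset.sum_eq_single (fun i => s.toMultiset.toList.get i)]
  · rw [Pi.single_eq_same, hprod, MvPolynomial.smul_monomial, smul_eq_mul, mul_one]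
  · intro f _ hf
    rw [Pi.single_eq_of_ne hf, zero_smul]
  · simp

end Phi

section Points

open MvPolynomial

variable {d : ℕ}

theorem permPoint_mul_permPoint {p b : Fin 4 → Fin d}
    (hpb : Function.Injective fun a => (p a, b a)) (σ τ : Equiv.Perm (Fin 4)) :
    permPoint τ (p, p ∘ σ) * permPoint τ (b, b ∘ σ) = if σ = τ then 1 else 0 := by
  simp only [permPoint]
  by_cases h : σ = τ
  · simp [h]
  · rw [if_neg h, mul_eq_zero]
    by_contra! hne
    simp only [ne_eq, ite_eq_right_iff, one_ne_zero, imp_false, not_not] at hne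
    exact h (Equiv.ext fun a => hpb (Prod.ext (congrFun hne.1 a) (congrFun hne.2 a)))

/-- The variable that takes the value `1` at every `permPoint`. -/
noncomputable def unitVar (z : Fin d) : MvPolynomial (Wix d) ℂ := X (fun _ => z, fun _ => z)

@[simp]
theorem eval_unitVar (z : Fin d) (σ : Equiv.Perm (Fin 4)) :
    eval (permPoint σ) (unitVar z) = 1 := by
  simp only [unitVar, eval_X, permPoint]
  exact if_pos rfl

/-- The product of the variables indexed by `(p, p ∘ σ)` and `(b, b ∘ σ)`. -/
noncomputable def pairQuadric (p b : Fin 4 → Fin d) (σ : Equiv.Perm (Fin 4)) :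
    MvPolynomial (Wix d) ℂ :=
  X (p, p ∘ σ) * X (b, b ∘ σ)

theorem eval_pairQuadric {p b : Fin 4 → Fin d} (hpb : Function.Injective fun a => (p a, b a))
    (σ τ : Equiv.Perm (Fin 4)) :
    eval (permPoint τ) (pairQuadric p b σ) = if σ = τ then 1 else 0 := by
  rw [pairQuadric, map_mul, eval_X, eval_X, permPoint_mul_permPoint hpb]

theorem unitVar_isHomogeneous (z : Fin d) : (unitVar z).IsHomogeneous 1 :=
  isHomogeneous_X _ _

theorem pairQuadric_isHomogeneous (p b : Fin 4 → Fin d) (σ : Equiv.Perm (Fin 4)) :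
    (pairQuadric p b σ).IsHomogeneous 2 :=
  (isHomogeneous_X _ _).mul (isHomogeneous_X _ _)

theorem unitVar_pow_mul_isHomogeneous (z : Fin d) (k : ℕ) {q : MvPolynomial (Wix d) ℂ} {m : ℕ}
    (hq : q.IsHomogeneous m) : (unitVar z ^ k * q).IsHomogeneous (m + k) := by
  have := ((unitVar_isHomogeneous z).pow k).mul hq
  rwa [one_mul, add_comm] at this

theorem exists_separating_words {z o : Fin d} (hzo : z ≠ o) :
    ∃ p b : Fin 4 → Fin d, Function.Injective fun a => (p a, b a) := by
  refine ⟨![z, z, o, o], ![z, o, z, o], fun a b hab => ?_⟩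
  fin_cases a <;> fin_cases b <;> simp_all [eq_comm]

/-- A word of length four over an alphabet either can be separated by a word in two letters,
or is constant away from one position. -/
theorem exists_separating_or_const_off_point {α : Type*} (p : Fin 4 → α) {z o : α} (hzo : z ≠ o) :
    (∃ b : Fin 4 → α, Function.Injective fun a => (p a, b a)) ∨
      ∃ (i : Fin 4) (x y : α), p = Function.update (fun _ => y) i x := by
  by_cases h1 : p 0 = p 1 ∨ p 2 = p 3
  · by_cases h2 : p 0 = p 2 ∨ p 1 = p 3
    · by_cases h3 : p 0 = p 3 ∨ p 1 = p 2
      · right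
        have key : ∃ i : Fin 4, ∃ y, ∀ j, j ≠ i → p j = y := by
          rcases h1 with h1 | h1 <;> rcases h2 with h2 | h2 <;> rcases h3 with h3 | h3
          · exact ⟨0, p 1, by simp [Fin.forall_fin_succ]; grind⟩
          · exact ⟨3, p 1, by simp [Fin.forall_fin_succ]; grind⟩
          · exact ⟨2, p 1, by simp [Fin.forall_fin_succ]; grind⟩
          · exact ⟨0, p 1, by simp [Fin.forall_fin_succ]; grind⟩
          · exact ⟨1, p 0, by simp [Fin.forall_fin_succ]; grind⟩
          · exact ⟨0, p 1, by simp [Fin.forall_fin_succ]; grind⟩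
          · exact ⟨0, p 1, by simp [Fin.forall_fin_succ]; grind⟩
          · exact ⟨0, p 1, by simp [Fin.forall_fin_succ]; grind⟩
        obtain ⟨i, y, hy⟩ := key
        refine ⟨i, p i, y, funext fun j => ?_⟩
        by_cases hj : j = i
        · simp [hj]
        · simp [hj, hy j hj]
      · push Not at h3
        refine .inl ⟨![z, o, o, z], fun a b hab => ?_⟩
        fin_cases a <;> fin_cases b <;> simp_all [eq_comm]
    · push Not at h2
      refine .inl ⟨![z, o, z, o], fun a b hab => ?_⟩
      fin_cases a <;> fin_cases b <;> simp_all [eq_comm]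
  · push Not at h1
    refine .inl ⟨![z, z, o, o], fun a b hab => ?_⟩
    fin_cases a <;> fin_cases b <;> simp_all [eq_comm]

theorem sum_pair_preimage (i j : Fin 4) (τ : Equiv.Perm (Fin 4)) :
    (∑ k ∈ Finset.univ.erase i, ∑ l ∈ Finset.univ.erase j,
      if ∀ m, (m = j ∨ m = l) ↔ (τ m = i ∨ τ m = k) then 1 else 0) =
      (if τ j = i then 2 else 0) + 1 := by
  have hiff {k l : Fin 4} (hk : k ≠ i) (hl : l ≠ j) :
      (∀ m, (m = j ∨ m = l) ↔ (τ m = i ∨ τ m = k)) ↔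
        (τ j = i ∧ τ l = k) ∨ (τ j = k ∧ τ l = i) := by
    have hne : τ l ≠ τ j := τ.injective.ne hl
    refine ⟨fun h => ?_, ?_⟩
    · have h1 := (h j).mp (.inl rfl)
      have h2 := (h l).mp (.inr rfl)
      grind
    · rintro (⟨rfl, rfl⟩ | ⟨rfl, rfl⟩) m <;> simp [or_comm]
  have hsum : (∑ k ∈ Finset.univ.erase i, ∑ l ∈ Finset.univ.erase j,
      if ∀ m, (m = j ∨ m = l) ↔ (τ m = i ∨ τ m = k) then 1 else 0) =
      ∑ k ∈ Finset.univ.erase i, ∑ l ∈ Finset.univ.erase j,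
        if (τ j = i ∧ τ l = k) ∨ (τ j = k ∧ τ l = i) then 1 else 0 :=
    Finset.sum_congr rfl fun k hk => Finset.sum_congr rfl fun l hl =>
      if_congr (hiff (Finset.ne_of_mem_erase hk) (Finset.ne_of_mem_erase hl)) rfl rfl
  rw [hsum]
  by_cases h : τ j = i
  · subst h
    have hrow : ∀ k ∈ Finset.univ.erase (τ j), (∑ l ∈ Finset.univ.erase j,
        if (τ j = τ j ∧ τ l = k) ∨ (τ j = k ∧ τ l = τ j) then 1 else 0) = 1 := by
      intro k hk
      have hk := Finset.ne_of_mem_erase hk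
      rw [Finset.sum_eq_single (τ.symm k)]
      · simp
      · intro l _ hl
        simp [hk.symm, ← Equiv.eq_symm_apply, hl]
      · simp [Equiv.symm_apply_eq, hk]
    rw [Finset.sum_congr rfl hrow]
    simp
  · rw [Finset.sum_eq_single (τ j), Finset.sum_eq_single (τ.symm i)]
    · simp [h]
    · intro l _ hl
      simp [h, ← Equiv.eq_symm_apply τ, hl]
    · simp [Equiv.symm_apply_eq, Ne.symm h]
    · intro k _ hk
      simp [h, hk.symm]
    · simp [h]

/-- The word with letter `o` at positions `i` and `k`, and letter `z` elsewhere. -/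
def pairWord (z o : Fin d) (i k : Fin 4) : Fin 4 → Fin d :=
  fun m => if m = i ∨ m = k then o else z

theorem permPoint_pairWord {z o : Fin d} (hzo : z ≠ o) (i j k l : Fin 4)
    (τ : Equiv.Perm (Fin 4)) :
    permPoint τ (pairWord z o i k, pairWord z o j l) =
      if ∀ m, (m = j ∨ m = l) ↔ (τ m = i ∨ τ m = k) then 1 else 0 := by
  simp only [permPoint, funext_iff, pairWord, Function.comp_apply]
  congr 1
  refine propext (forall_congr' fun m => ?_)
  split_ifs <;> simp_all [eq_comm]

theorem exists_separating_pairWord {z o : Fin d} (hzo : z ≠ o) {i k : Fin 4} (hik : i ≠ k) :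
    ∃ b : Fin 4 → Fin d, Function.Injective fun a => (pairWord z o i k a, b a) := by
  have : ∀ i k : Fin 4, i ≠ k → ∃ c : Fin 4 → Bool, ∀ a b,
      ((a = i ∨ a = k) ↔ (b = i ∨ b = k)) → c a = c b → a = b := by decide
  obtain ⟨c, hc⟩ := this i k hik
  refine ⟨fun a => if c a then o else z, fun a b hab => ?_⟩
  simp only [Prod.mk.injEq, pairWord] at hab
  refine hc a b ?_ ?_
  · have := hab.1
    split_ifs at this <;> simp_all
  · have := hab.2
    split_ifs at this <;> simp_all

theorem permPoint_update {x y : Fin d} (hxy : x ≠ y) (i j : Fin 4) (τ : Equiv.Perm (Fin 4)) :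
    permPoint τ (Function.update (fun _ => y) i x, Function.update (fun _ => y) j x) =
      if τ j = i then 1 else 0 := by
  simp only [permPoint, funext_iff, Function.comp_apply, Function.update_apply]
  congr 1
  refine propext ⟨fun h => ?_, fun h m => ?_⟩
  · have := h j
    by_contra hne
    simp [hne, hxy] at this
  · simp [← h]

end Points

section Ideal

open MvPolynomial

variable {d k : ℕ} {J : Ideal (MvPolynomial (Wix d) ℂ)}

/-- The map sending `L` to `(L - L(σ) x₀) x₀ ^ k Q`, where `L(σ)` is the value of `L` at the
point of `σ`, `x₀` is `unitVar z` and `Q` is the quadric of `σ`. -/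
noncomputable def deviation (z : Fin d) (p b : Fin 4 → Fin d) (k : ℕ) (σ : Equiv.Perm (Fin 4)) :
    MvPolynomial (Wix d) ℂ →ₗ[ℂ] MvPolynomial (Wix d) ℂ :=
  LinearMap.mulRight ℂ (unitVar z ^ k * pairQuadric p b σ) ∘ₗ
    (LinearMap.id - (aeval (permPoint σ)).toLinearMap.smulRight (unitVar z))

theorem deviation_apply (z : Fin d) (p b : Fin 4 → Fin d) (σ : Equiv.Perm (Fin 4))
    (L : MvPolynomial (Wix d) ℂ) :
    deviation z p b k σ L =
      (L - C (eval (permPoint σ) L) * unitVar z) * (unitVar z ^ k * pairQuadric p b σ) := by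
  simp [deviation, aeval_eq_eval, smul_eq_C_mul, mul_assoc]

theorem deviation_unitVar (z : Fin d) (p b : Fin 4 → Fin d) (σ : Equiv.Perm (Fin 4)) :
    deviation z p b k σ (unitVar z) = 0 := by
  simp [deviation_apply]

theorem deviation_mem_of_vanishing
    (hJ : ∀ f : MvPolynomial (Wix d) ℂ, f.IsHomogeneous (k + 2) →
      (∀ τ, eval (permPoint τ) f = 0) → f ∈ J)
    (z : Fin d) (p b : Fin 4 → Fin d) (σ : Equiv.Perm (Fin 4))
    {L : MvPolynomial (Wix d) ℂ} (hL : L.IsHomogeneous 1) (h0 : ∀ τ, eval (permPoint τ) L = 0) :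
    deviation z p b k σ L ∈ J := by
  have hmem : unitVar z ^ k * (L * X (p, p ∘ σ)) ∈ J := by
    refine hJ _ ?_ fun τ => by simp [h0]
    rw [add_comm k]
    exact unitVar_pow_mul_isHomogeneous z k (hL.mul (isHomogeneous_X _ _))
  convert J.mul_mem_right (X (b, b ∘ σ)) hmem using 1
  rw [deviation_apply, h0, pairQuadric, C_0]
  ring

theorem deviation_X_mem_of_separating
    (hJ : ∀ f : MvPolynomial (Wix d) ℂ, f.IsHomogeneous (k + 2) →
      (∀ τ, eval (permPoint τ) f = 0) → f ∈ J)
    (z : Fin d) {p₀ b₀ : Fin 4 → Fin d}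
    (h₀ : Function.Injective fun a => (p₀ a, b₀ a)) {p b : Fin 4 → Fin d}
    (hpb : Function.Injective fun a => (p a, b a)) (q : Fin 4 → Fin d)
    (σ : Equiv.Perm (Fin 4)) : deviation z p₀ b₀ k σ (X (p, q)) ∈ J := by
  have h1 : unitVar z ^ k * (pairQuadric p₀ b₀ σ - pairQuadric p b σ) ∈ J := by
    refine hJ _ ?_ fun τ => by
      rw [map_mul, map_sub, eval_pairQuadric h₀, eval_pairQuadric hpb, sub_self, mul_zero]
    rw [add_comm k]
    exact unitVar_pow_mul_isHomogeneous z k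
      ((pairQuadric_isHomogeneous _ _ _).sub (pairQuadric_isHomogeneous _ _ _))
  have h2 : unitVar z ^ k *
      ((X (p, q) - C (permPoint σ (p, q)) * unitVar z) * X (p, p ∘ σ)) ∈ J := by
    refine hJ _ ?_ fun τ => ?_
    · rw [add_comm k]
      exact unitVar_pow_mul_isHomogeneous z k
        (((isHomogeneous_X _ _).sub ((unitVar_isHomogeneous z).C_mul _)).mul
          (isHomogeneous_X _ _))
    · simp only [map_mul, map_pow, map_sub, eval_X, eval_C, eval_unitVar, permPoint]
      by_cases h : p ∘ σ = p ∘ τ <;> simp [h]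
  have := J.add_mem (J.mul_mem_left (X (p, q) - C (permPoint σ (p, q)) * unitVar z) h1)
    (J.mul_mem_right (X (b, b ∘ σ)) h2)
  convert this using 1
  rw [deviation_apply, eval_X, pairQuadric, pairQuadric]
  ring

theorem deviation_X_mem
    (hJ : ∀ f : MvPolynomial (Wix d) ℂ, f.IsHomogeneous (k + 2) →
      (∀ τ, eval (permPoint τ) f = 0) → f ∈ J)
    {z o : Fin d} (hzo : z ≠ o) {p₀ b₀ : Fin 4 → Fin d}
    (h₀ : Function.Injective fun a => (p₀ a, b₀ a)) (w : Wix d) (σ : Equiv.Perm (Fin 4)) :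
    deviation z p₀ b₀ k σ (X w) ∈ J := by
  obtain ⟨p, q⟩ := w
  obtain ⟨b, hb⟩ | ⟨i, x, y, rfl⟩ := exists_separating_or_const_off_point p hzo
  · exact deviation_X_mem_of_separating hJ z h₀ hb q σ
  by_cases hxy : x = y
  · have hval (τ : Equiv.Perm (Fin 4)) :
        permPoint τ (Function.update (fun _ => y) i x, q) = if q = fun _ => y then 1 else 0 := by
      subst hxy
      simp [permPoint, Function.comp_def]
    have := deviation_mem_of_vanishing hJ z p₀ b₀ σ
      (L := X (Function.update (fun _ => y) i x, q) -
        C (if q = fun _ => y then 1 else 0) * unitVar z)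
      ((isHomogeneous_X _ _).sub ((unitVar_isHomogeneous z).C_mul _)) fun τ => by
        rw [map_sub, map_mul, eval_X, eval_C, eval_unitVar, hval, mul_one, sub_self]
    rwa [← smul_eq_C_mul, map_sub, map_smul, deviation_unitVar, smul_zero, sub_zero] at this
  by_cases hq : ∃ j, q = Function.update (fun _ => y) j x
  · obtain ⟨j, rfl⟩ := hq
    let S : MvPolynomial (Wix d) ℂ := ∑ a ∈ Finset.univ.erase i, ∑ l ∈ Finset.univ.erase j,
      X (pairWord z o i a, pairWord z o j l)
    have hS : deviation z p₀ b₀ k σ S ∈ J := by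
      simp only [S, map_sum]
      refine J.sum_mem fun a ha => J.sum_mem fun l _ => ?_
      obtain ⟨b, hb⟩ := exists_separating_pairWord hzo (Finset.ne_of_mem_erase ha).symm
      exact deviation_X_mem_of_separating hJ z h₀ hb _ σ
    have hL := deviation_mem_of_vanishing hJ z p₀ b₀ σ
      (L := C 2 * X (Function.update (fun _ => y) i x, Function.update (fun _ => y) j x) +
        unitVar z - S)
      ((((isHomogeneous_X _ _).C_mul _).add (unitVar_isHomogeneous z)).sub
        (.sum _ _ _ fun _ _ => .sum _ _ _ fun _ _ => isHomogeneous_X _ _)) (fun τ => by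
          have := congrArg (Nat.cast (R := ℂ)) (sum_pair_preimage i j τ)
          push_cast at this
          simp only [S, map_sub, map_add, map_mul, map_sum, eval_C, eval_X, eval_unitVar,
            permPoint_pairWord hzo, permPoint_update hxy, this]
          split_ifs <;> simp)
    rw [← smul_eq_C_mul, map_sub, map_add, map_smul, deviation_unitVar, add_zero] at hL
    have := J.mul_mem_left (C (1 / 2)) (J.add_mem hL hS)
    rwa [sub_add_cancel, smul_eq_C_mul, ← mul_assoc, ← C_mul,
      show (1 / 2 * 2 : ℂ) = 1 by norm_num, C_1, one_mul] at this
  · refine deviation_mem_of_vanishing hJ z p₀ b₀ σ (isHomogeneous_X _ _) fun τ => ?_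
    rw [eval_X, permPoint, if_neg]
    intro h
    refine hq ⟨τ.symm i, funext fun m => (congrFun h m).trans ?_⟩
    simp [Function.update_apply, Equiv.eq_symm_apply]

/-- Modulo an ideal containing all forms of degree `k + 2` that vanish at the points
`permPoint σ`, every monomial of degree at least `k + 2` is its own interpolation. -/
theorem prod_X_sub_interpolation_mem
    (hJ : ∀ f : MvPolynomial (Wix d) ℂ, f.IsHomogeneous (k + 2) →
      (∀ τ, eval (permPoint τ) f = 0) → f ∈ J)
    {z o : Fin d} (hzo : z ≠ o) {p b : Fin 4 → Fin d}
    (hpb : Function.Injective fun a => (p a, b a)) (m : ℕ) (P : Fin (k + 2 + m) → Wix d) :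
    ∏ i, X (P i) - ∑ σ, C (∏ i, permPoint σ (P i)) *
      (unitVar z ^ (k + m) * pairQuadric p b σ) ∈ J := by
  induction m with
  | zero =>
    refine hJ _ (.sub ?_ (.sum _ _ _ fun σ _ => .C_mul ?_ _)) fun τ => ?_
    · simpa using IsHomogeneous.prod Finset.univ
        (fun i => (X (P i) : MvPolynomial (Wix d) ℂ)) (fun _ => 1) fun i _ => isHomogeneous_X _ _
    · rw [add_zero, add_comm k]
      exact unitVar_pow_mul_isHomogeneous z k (pairQuadric_isHomogeneous _ _ _)
    · simp [eval_pairQuadric hpb, map_prod]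
  | succ m ih =>
    have hprod {M : Type} [CommMonoid M] (F : Fin (k + 2 + (m + 1)) → M) :
        ∏ i, F i = F 0 * ∏ i : Fin (k + 2 + m), F i.succ := Fin.prod_univ_succ (n := k + 2 + m) F
    have h1 := J.mul_mem_left (X (P 0)) (ih fun i => P i.succ)
    have h2 : ∑ σ, C (∏ i : Fin (k + 2 + m), permPoint σ (P i.succ)) * unitVar z ^ m *
        deviation z p b k σ (X (P 0)) ∈ J :=
      J.sum_mem fun σ _ => J.mul_mem_left _ (deviation_X_mem hJ hzo hpb _ σ)
    convert J.add_mem h1 h2 using 1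
    rw [mul_sub, ← hprod fun i => (X (P i) : MvPolynomial (Wix d) ℂ), sub_add,
      Finset.mul_sum, ← Finset.sum_sub_distrib]
    congr 1
    refine Finset.sum_congr rfl fun σ _ => ?_
    rw [hprod fun i => permPoint σ (P i), deviation_apply, eval_X, C_mul]
    ring

theorem mem_of_isHomogeneous_of_vanishing
    (hJ : ∀ f : MvPolynomial (Wix d) ℂ, f.IsHomogeneous (k + 2) →
      (∀ τ, eval (permPoint τ) f = 0) → f ∈ J)
    {z o : Fin d} (hzo : z ≠ o) {p b : Fin 4 → Fin d}
    (hpb : Function.Injective fun a => (p a, b a)) (m : ℕ) {f : MvPolynomial (Wix d) ℂ}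
    (hf : f.IsHomogeneous (k + 2 + m)) (h0 : ∀ τ, eval (permPoint τ) f = 0) : f ∈ J := by
  obtain ⟨v, rfl⟩ := exists_phi_eq_of_isHomogeneous hf
  have hmem : ∑ P, C (v P) * (∏ i, X (P i) - ∑ σ, C (∏ i, permPoint σ (P i)) *
      (unitVar z ^ (k + m) * pairQuadric p b σ)) ∈ J :=
    J.sum_mem fun P _ => J.mul_mem_left _ (prod_X_sub_interpolation_mem hJ hzo hpb m P)
  have hzero : ∑ P, C (v P) * ∑ σ, C (∏ i, permPoint σ (P i)) *
      (unitVar z ^ (k + m) * pairQuadric p b σ) = 0 := by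
    simp only [Finset.mul_sum]
    rw [Finset.sum_comm]
    refine Finset.sum_eq_zero fun σ _ => ?_
    have := h0 σ
    rw [eval_phi] at this
    simp only [← mul_assoc, ← C_mul, ← Finset.sum_mul]
    rw [← map_sum, this, C_0, zero_mul, zero_mul]
  simp only [mul_sub, Finset.sum_sub_distrib] at hmem
  rw [hzero, sub_zero] at hmem
  simpa [phi, smul_eq_C_mul] using hmem

end Ideal

section HilbertFunction

open MvPolynomial

theorem finrank_quotient_of_vanishing {d : ℕ} (z : Fin d) {p b : Fin 4 → Fin d}
    (hpb : Function.Injective fun a => (p a, b a)) {J : Ideal (MvPolynomial (Wix d) ℂ)} (m : ℕ)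
    (hJ : ∀ f : MvPolynomial (Wix d) ℂ, f.IsHomogeneous (2 + m) →
      (f ∈ J ↔ ∀ τ, eval (permPoint τ) f = 0)) :
    hilb J (2 + m) = 24 := by
  let ev : homogeneousSubmodule (Wix d) ℂ (2 + m) →ₗ[ℂ] (Equiv.Perm (Fin 4) → ℂ) :=
    LinearMap.pi fun σ => (aeval (permPoint σ)).toLinearMap ∘ₗ Submodule.subtype _
  have hev (f : homogeneousSubmodule (Wix d) ℂ (2 + m)) (σ) :
      ev f σ = eval (permPoint σ) (f : MvPolynomial (Wix d) ℂ) := by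
    simp [ev, aeval_eq_eval]
  have hsurj : Function.Surjective ev := by
    intro c
    refine ⟨⟨∑ σ, C (c σ) * (unitVar z ^ m * pairQuadric p b σ), .sum _ _ _ fun σ _ => .C_mul
      (unitVar_pow_mul_isHomogeneous z m (pairQuadric_isHomogeneous _ _ _)) _⟩, ?_⟩
    ext τ
    simp [hev, eval_pairQuadric hpb]
  have hker : Submodule.comap (homogeneousSubmodule (Wix d) ℂ (2 + m)).subtype
      (Submodule.restrictScalars ℂ J) = LinearMap.ker ev := by
    ext f
    simp only [Submodule.mem_comap, Submodule.restrictScalars_mem, Submodule.subtype_apply,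
      LinearMap.mem_ker, funext_iff, hev, Pi.zero_apply]
    exact hJ _ f.2
  rw [hilb, hker, (ev.quotKerEquivOfSurjective hsurj).finrank_eq,
    Module.finrank_fintype_fun_eq_card, Fintype.card_perm]
  rfl

theorem mem_Jideal_iff {d n : ℕ} {z o : Fin d} (hzo : z ≠ o) (hd : 2 ≤ d) (hn : 2 ≤ n)
    {N : ℕ} (h : n ≤ N) {f : MvPolynomial (Wix d) ℂ} (hf : f.IsHomogeneous N) :
    f ∈ Jideal d n ⊤ ↔ ∀ τ, eval (permPoint τ) f = 0 := by
  have hcard : 4 ≤ d ^ n := (Nat.pow_le_pow_left hd 2).trans (Nat.pow_le_pow_right (by omega) hn)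
  constructor
  · intro hmem τ
    have hle : Jideal d n ⊤ ≤ RingHom.ker (eval (permPoint τ)) := by
      refine Ideal.span_le.mpr ?_
      rintro _ ⟨v, hv, rfl⟩
      exact (mem_wAnn_iff hcard v).mp hv τ
    exact hle hmem
  · intro h0
    obtain ⟨k, rfl⟩ := Nat.exists_eq_add_of_le' hn
    obtain ⟨m, rfl⟩ := Nat.exists_eq_add_of_le h
    obtain ⟨p, b, hpb⟩ := exists_separating_words hzo
    refine mem_of_isHomogeneous_of_vanishing (fun g hg hg0 => ?_) hzo hpb m hf h0
    obtain ⟨v, rfl⟩ := exists_phi_eq_of_isHomogeneous hg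
    exact Ideal.subset_span ⟨v, (mem_wAnn_iff hcard v).mpr hg0, rfl⟩

end HilbertFunction

/-- For `d, n ≥ 2` and `G = GL((ℂ^d)^{⊗n})` the full general linear
group, `dim_ℂ (R^N / J^N(G)) = 24` for every `N ≥ n`. -/
theorem hilbert_function_of_full_GL {d n : ℕ} (hd : 2 ≤ d) (hn : 2 ≤ n)
    (N : ℕ) (h : n ≤ N) :
    hilb (Jideal d n (⊤ : Subgroup (Matrix (Fin n → Fin d) (Fin n → Fin d) ℂ)ˣ)) N = 24 := by
  have hzo : (⟨0, by omega⟩ : Fin d) ≠ ⟨1, by omega⟩ := by simp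
  obtain ⟨p, b, hpb⟩ := exists_separating_words hzo
  obtain ⟨m, rfl⟩ := Nat.exists_eq_add_of_le (hn.trans h)
  exact finrank_quotient_of_vanishing ⟨0, by omega⟩ hpb m fun f hf =>
    mem_Jideal_iff hzo hd hn h hf
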